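/- One has the limit lim_{n → ∞} 2^{3n/2} ‖g_n · ∂_x f_n‖_{L²(ℝ)} = 2^{-1/2} ‖φ²‖_{L²(ℝ)}; in particular there exists a constant M₁ > 0 such that liminf_{n → ∞} 2^{3n/2} ‖g_n · ∂_x f_n‖_{L²(ℝ)} ≥ M₁. -/

import Mathlib

open MeasureTheory Filter

/-- The Fourier transform with normalization `𝓕f(ξ) = ∫ e^{-ixξ} f(x) dx`. -/
noncomputable def FT (f : ℝ → ℝ) (ξ : ℝ) : ℂ :=
  ∫ x : ℝ, Complex.exp (-(Complex.I * ξ * x)) * (f x : ℂ)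

/-- The **Riemann-Lebesgue lemma** for the kernel `e^{-iwx}`. -/
theorem tendsto_integral_exp_mul_atTop {h : ℝ → ℝ} :
    Tendsto (fun w : ℝ => ∫ x, Complex.exp (-(w * x : ℝ) * Complex.I) * (h x : ℂ)) atTop
      (nhds 0) := by
  have hw : Tendsto (fun w : ℝ => w / (2 * Real.pi)) atTop (cocompact ℝ) :=
    (tendsto_id.atTop_div_const (by positivity)).mono_right atTop_le_cocompact
  refine ((Real.tendsto_integral_exp_smul_cocompact fun x => (h x : ℂ)).comp hw).congr fun w => ?_
  refine integral_congr_ae (.of_forall fun x => ?_)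
  simp only [Circle.smul_def, Real.fourierChar_apply, smul_eq_mul]
  congr 3
  have hpi : (Real.pi : ℂ) ≠ 0 := by exact_mod_cast Real.pi_ne_zero
  push_cast
  field_simp

theorem integrable_exp_mul {h : ℝ → ℝ} (hh : Integrable h) (w : ℝ) :
    Integrable fun x : ℝ => Complex.exp (-(w * x : ℝ) * Complex.I) * (h x : ℂ) := by
  refine hh.ofReal.bdd_mul (c := 1) (by fun_prop) (.of_forall fun x => ?_)
  rw [← Complex.ofReal_neg, Complex.norm_exp_ofReal_mul_I]

theorem tendsto_integral_mul_cos_atTop {h : ℝ → ℝ} (hh : Integrable h) :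
    Tendsto (fun w : ℝ => ∫ x, h x * Real.cos (w * x)) atTop (nhds 0) := by
  have key := (Complex.continuous_re.tendsto 0).comp (tendsto_integral_exp_mul_atTop (h := h))
  refine key.congr fun w => ?_
  refine (integral_re (integrable_exp_mul hh w)).symm.trans ?_
  refine integral_congr_ae (.of_forall fun x => ?_)
  simp only [← Complex.ofReal_neg, RCLike.re_to_complex, Complex.re_mul_ofReal,
    Complex.exp_ofReal_mul_I_re, Real.cos_neg, mul_comm (Real.cos _)]

theorem tendsto_integral_mul_sin_atTop {h : ℝ → ℝ} (hh : Integrable h) :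
    Tendsto (fun w : ℝ => ∫ x, h x * Real.sin (w * x)) atTop (nhds 0) := by
  have key := ((Complex.continuous_im.tendsto 0).comp
    (tendsto_integral_exp_mul_atTop (h := h))).neg
  rw [Complex.zero_im, neg_zero] at key
  refine key.congr fun w => ?_
  refine (congrArg Neg.neg (integral_im (integrable_exp_mul hh w)).symm).trans ?_
  rw [← integral_neg]
  refine integral_congr_ae (.of_forall fun x => ?_)
  simp only [← Complex.ofReal_neg, RCLike.im_to_complex, Complex.im_mul_ofReal,
    Complex.exp_ofReal_mul_I_im, Real.sin_neg, neg_mul, neg_neg, mul_comm (Real.sin _)]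

theorem tendsto_integral_sq_cos_add_inv_mul_sin {a b : ℝ → ℝ}
    (haa : Integrable fun x => a x ^ 2) (hab : Integrable fun x => a x * b x)
    (hbb : Integrable fun x => b x ^ 2) :
    Tendsto (fun w : ℝ => ∫ x, (a x * Real.cos (w * x) + w⁻¹ * (b x * Real.sin (w * x))) ^ 2)
      atTop (nhds (1 / 2 * ∫ x, a x ^ 2)) := by
  have h2 : Tendsto (fun w : ℝ => 2 * w) atTop atTop := tendsto_id.const_mul_atTop two_pos
  have hinv : Tendsto (fun w : ℝ => w⁻¹) atTop (nhds 0) := tendsto_inv_atTop_zero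
  have hc {h : ℝ → ℝ} (hh : Integrable h) (w : ℝ) :
      Integrable fun x => h x * Real.cos (2 * w * x) :=
    hh.mul_bdd (c := 1) (by fun_prop) (.of_forall fun x => Real.abs_cos_le_one _)
  have hs {h : ℝ → ℝ} (hh : Integrable h) (w : ℝ) :
      Integrable fun x => h x * Real.sin (2 * w * x) :=
    hh.mul_bdd (c := 1) (by fun_prop) (.of_forall fun x => Real.abs_sin_le_one _)
  have key := (((tendsto_const_nhds (x := ∫ x, a x ^ 2)).add
      ((tendsto_integral_mul_cos_atTop haa).comp h2)).const_mul (1 / 2)).add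
    ((hinv.mul ((tendsto_integral_mul_sin_atTop hab).comp h2)).add
      ((hinv.pow 2).mul (((tendsto_const_nhds (x := ∫ x, b x ^ 2)).sub
        ((tendsto_integral_mul_cos_atTop hbb).comp h2)).const_mul (1 / 2))))
  simp only [add_zero, mul_zero, ne_eq, OfNat.ofNat_ne_zero, not_false_eq_true, zero_pow,
    zero_mul] at key
  refine key.congr fun w => ?_
  have hA : Integrable fun x => 1 / 2 * (a x ^ 2 + a x ^ 2 * Real.cos (2 * w * x)) :=
    (haa.add (hc haa w)).const_mul _
  have hB : Integrable fun x => w⁻¹ * (a x * b x * Real.sin (2 * w * x)) :=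
    (hs hab w).const_mul _
  have hC : Integrable fun x =>
      w⁻¹ ^ 2 * (1 / 2 * (b x ^ 2 - b x ^ 2 * Real.cos (2 * w * x))) :=
    ((hbb.sub (hc hbb w)).const_mul _).const_mul _
  simp only [Function.comp_apply]
  rw [← integral_add haa (hc haa w), ← integral_sub hbb (hc hbb w), ← integral_const_mul,
    ← integral_const_mul, ← integral_const_mul, ← integral_const_mul,
    ← integral_add hB hC]
  refine (integral_add hA (hB.add hC)).symm.trans ?_
  refine integral_congr_ae (.of_forall fun x => ?_)
  simp only [Pi.add_apply, mul_assoc 2 w x, Real.sin_two_mul, Real.cos_two_mul]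
  linear_combination (w⁻¹ ^ 2 * b x ^ 2) * -(Real.sin_sq_add_cos_sq (w * x))

theorem toReal_eLpNorm_two_eq_sqrt {h : ℝ → ℝ} (hh : AEStronglyMeasurable h) :
    (eLpNorm h 2 volume).toReal = √(∫ x, h x ^ 2) := by
  rw [toReal_eLpNorm hh, lpNorm_eq_integral_norm_rpow_toReal two_ne_zero ENNReal.ofNat_ne_top hh,
    Real.sqrt_eq_rpow]
  simp

theorem SchwartzMap.integrable_mul_mul_mul (φ₁ φ₂ φ₃ φ₄ : SchwartzMap ℝ ℝ) :
    Integrable fun x => φ₁ x * (φ₂ x * (φ₃ x * φ₄ x)) := by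
  have hb (ψ : SchwartzMap ℝ ℝ) (x : ℝ) : |ψ x| ≤ SchwartzMap.seminorm ℝ 0 0 ψ :=
    ψ.norm_le_seminorm ℝ x
  refine φ₁.integrable.mul_bdd (c := SchwartzMap.seminorm ℝ 0 0 φ₂ *
    (SchwartzMap.seminorm ℝ 0 0 φ₃ * SchwartzMap.seminorm ℝ 0 0 φ₄))
    (by fun_prop) (.of_forall fun x => ?_)
  rw [Real.norm_eq_abs, abs_mul, abs_mul]
  have h2 := hb φ₂ x
  have h3 := hb φ₃ x
  have h4 := hb φ₄ x
  exact mul_le_mul h2 (mul_le_mul h3 h4 (abs_nonneg _) ((abs_nonneg _).trans h3)) (by positivity)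
    ((abs_nonneg _).trans h2)

theorem two_rpow_mul_mul_deriv_eq (φ : SchwartzMap ℝ ℝ) (f g : ℕ → ℝ → ℝ)
    (hf : ∀ n x, f n x = (2:ℝ) ^ (-(3 * (n:ℝ)) / 2) * φ x * Real.sin ((17/12) * 2^n * x))
    (hg : ∀ n x, g n x = (12/17) * (2:ℝ) ^ (-(n:ℝ)) * φ x) (n : ℕ) (x : ℝ) :
    (2:ℝ) ^ ((3 * (n:ℝ)) / 2) * (g n x * deriv (f n) x) =
      φ x ^ 2 * Real.cos ((17/12) * 2^n * x) +
        ((17/12) * 2^n : ℝ)⁻¹ * (φ x * deriv φ x * Real.sin ((17/12) * 2^n * x)) := by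
  have hd : HasDerivAt (f n) ((2:ℝ) ^ (-(3 * (n:ℝ)) / 2) * deriv φ x *
      Real.sin ((17/12) * 2^n * x) + (2:ℝ) ^ (-(3 * (n:ℝ)) / 2) * φ x *
        (Real.cos ((17/12) * 2^n * x) * ((17/12) * 2^n * 1))) x := by
    rw [funext (hf n)]
    exact (φ.differentiableAt.hasDerivAt.const_mul _).mul
      (((hasDerivAt_id x).const_mul ((17/12) * 2^n : ℝ)).sin)
  have h1 : (2:ℝ) ^ ((3 * (n:ℝ)) / 2) * (2:ℝ) ^ (-(3 * (n:ℝ)) / 2) = 1 := by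
    rw [← Real.rpow_add two_pos, neg_div, add_neg_cancel, Real.rpow_zero]
  rw [hd.deriv, hg, Real.rpow_neg zero_le_two, Real.rpow_natCast]
  have h2 : (2:ℝ) ^ n ≠ 0 := by positivity
  generalize (2:ℝ) ^ ((3 * (n:ℝ)) / 2) = A at *
  generalize (2:ℝ) ^ (-(3 * (n:ℝ)) / 2) = B at *
  generalize Real.sin ((17/12) * 2^n * x) = S
  generalize Real.cos ((17/12) * 2^n * x) = C
  field_simp
  linear_combination (φ x * (12 * deriv φ x * S + φ x * 2 ^ n * 17 * C)) * h1

theorem stmt9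
    (φhat : ℝ → ℝ) (hsmooth : ContDiff ℝ (⊤ : ℕ∞) φhat) (hsupp : HasCompactSupport φhat)
    (heven : ∀ ξ, φhat (-ξ) = φhat ξ)
    (hrange : ∀ ξ, 0 ≤ φhat ξ ∧ φhat ξ ≤ 1)
    (hone : ∀ ξ, |ξ| ≤ 1/4 → φhat ξ = 1)
    (hzero : ∀ ξ, 1/2 ≤ |ξ| → φhat ξ = 0)
    (φ : SchwartzMap ℝ ℝ)
    (hφ : ∀ ξ, FT (fun x => φ x) ξ = (φhat ξ : ℂ))
    (f g : ℕ → ℝ → ℝ)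
    (hf : ∀ n x, f n x = (2:ℝ) ^ (-(3 * (n:ℝ)) / 2) * φ x * Real.sin ((17/12) * 2^n * x))
    (hg : ∀ n x, g n x = (12/17) * (2:ℝ) ^ (-(n:ℝ)) * φ x) :
    Tendsto
      (fun n : ℕ => (2:ℝ) ^ ((3 * (n:ℝ)) / 2) *
        (eLpNorm (fun x => g n x * deriv (f n) x) 2 volume).toReal)
      atTop
      (nhds ((2:ℝ) ^ (-(1:ℝ) / 2) * (eLpNorm (fun x => (φ x) ^ 2) 2 volume).toReal)) ∧
    ∃ M₁ > (0:ℝ), M₁ ≤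
      Filter.liminf
        (fun n : ℕ => (2:ℝ) ^ ((3 * (n:ℝ)) / 2) *
          (eLpNorm (fun x => g n x * deriv (f n) x) 2 volume).toReal)
        atTop := by
  have hφ_ne : ¬ (fun x => φ x ^ 2) =ᵐ[volume] 0 := by
    intro h0
    have h1 := hφ 0
    rw [hone 0 (by norm_num), FT, integral_eq_zero_of_ae] at h1
    · norm_num at h1
    · filter_upwards [h0] with x hx
      simp [pow_eq_zero_iff two_ne_zero |>.mp hx]
  have hdc : Continuous (deriv φ) := (SchwartzMap.derivCLM ℝ ℝ φ).continuous
  have hsq : AEStronglyMeasurable fun x => φ x ^ 2 := by fun_prop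
  have hpos : 0 < (eLpNorm (fun x => φ x ^ 2) 2 volume).toReal := by
    have hmem : MemLp (fun x => φ x ^ 2) 2 volume :=
      (memLp_two_iff_integrable_sq hsq).2 <|
        (φ.integrable_mul_mul_mul φ φ φ).congr (.of_forall fun x => by ring)
    rw [toReal_eLpNorm hsq]
    exact lpNorm_nonneg.lt_of_ne' fun h => hφ_ne ((lpNorm_eq_zero hmem two_ne_zero).1 h)
  have hlim : Tendsto
      (fun n : ℕ => (2:ℝ) ^ ((3 * (n:ℝ)) / 2) *
        (eLpNorm (fun x => g n x * deriv (f n) x) 2 volume).toReal)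
      atTop
      (nhds ((2:ℝ) ^ (-(1:ℝ) / 2) * (eLpNorm (fun x => (φ x) ^ 2) 2 volume).toReal)) := by
    have hw : Tendsto (fun n : ℕ => (17/12 : ℝ) * 2 ^ n) atTop atTop :=
      (tendsto_pow_atTop_atTop_of_one_lt one_lt_two).const_mul_atTop (by norm_num)
    let ψ := SchwartzMap.derivCLM ℝ ℝ φ
    have key := ((tendsto_integral_sq_cos_add_inv_mul_sin (a := fun x => φ x ^ 2)
      (b := fun x => φ x * deriv φ x)
      ((φ.integrable_mul_mul_mul φ φ φ).congr (.of_forall fun x => by ring))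
      ((φ.integrable_mul_mul_mul φ φ ψ).congr
        (.of_forall fun x => by simp only [ψ, SchwartzMap.derivCLM_apply]; ring))
      ((φ.integrable_mul_mul_mul ψ φ ψ).congr
        (.of_forall fun x => by simp only [ψ, SchwartzMap.derivCLM_apply]; ring))).comp hw).sqrt
    have hconst : √(1 / 2 * ∫ x, (φ x ^ 2) ^ 2) =
        (2:ℝ) ^ (-(1:ℝ) / 2) * (eLpNorm (fun x => (φ x) ^ 2) 2 volume).toReal := by
      rw [toReal_eLpNorm_two_eq_sqrt hsq, Real.sqrt_mul (by norm_num), Real.sqrt_eq_rpow (1 / 2),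
        one_div, Real.inv_rpow zero_le_two, ← Real.rpow_neg zero_le_two, neg_div, one_div]
    rw [hconst] at key
    refine key.congr fun n => ?_
    have hc : (2:ℝ) ^ ((3 * (n:ℝ)) / 2) ≠ 0 := by positivity
    have heq : (fun x => g n x * deriv (f n) x) = fun x => ((2:ℝ) ^ ((3 * (n:ℝ)) / 2))⁻¹ *
        (φ x ^ 2 * Real.cos ((17/12) * 2^n * x) +
          ((17/12) * 2^n : ℝ)⁻¹ * (φ x * deriv φ x * Real.sin ((17/12) * 2^n * x))) := by
      ext x
      rw [← two_rpow_mul_mul_deriv_eq φ f g hf hg, inv_mul_cancel_left₀ hc]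
    have hmeas : AEStronglyMeasurable (fun x => g n x * deriv (f n) x) := by
      rw [heq]
      fun_prop
    rw [toReal_eLpNorm_two_eq_sqrt hmeas, Function.comp_apply,
      ← Real.sqrt_sq (show 0 ≤ (2:ℝ) ^ ((3 * (n:ℝ)) / 2) by positivity),
      ← Real.sqrt_mul (sq_nonneg _), ← integral_const_mul]
    simp only [← mul_pow, two_rpow_mul_mul_deriv_eq φ f g hf hg]
  exact ⟨hlim, _, by positivity, hlim.liminf_eq.ge⟩
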